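/- arXiv:1806.08549 — 2 statements merged into one kernel-verified Lean document; each statement's English description precedes it below -/
import Mathlib

section
/- (Proposition 1 of the paper, ν- and Γ-components.) Consider two labels with the same current customer n₀, expected remaining-cost functions ν¹, ν² : {0,…,Q} → ℝ with ν¹(q) ≤ ν²(q) for all q ∈ {0,…,Q}, and accumulated dual contributions Γ¹ ≤ Γ² in ℝ. Extend both labels backwardly along the same finite sequence of customers (i_1,…,i_h), where extending a label with current customer m to customer i replaces its ν-function by (T_{i,m} ν)(q) = min( d(i,m) + Σ_{k=0}^∞ [(d(m,0)+d(0,m))·Ψ(k,q) + ν(Q·Ψ(k,q)+q−k)]·p_m(k) , d(i,0) + d(0,m) + Σ_{k=0}^∞ [(d(m,0)+d(0,m))·Ψ(k,Q) + ν(Q·Ψ(k,Q)+Q−k)]·p_m(k) ), adds γ(i,m) to Γ, and sets the current customer to i. Then after the common extension the resulting labels satisfy ν¹'(q) ≤ ν²'(q) for all q ∈ {0,…,Q} and Γ¹' ≤ Γ²'; i.e., dominance in the ν- and Γ-attributes is preserved by common extensions. -/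
/-- `Ψ(k,q) = max(⌈(k−q)/Q⌉, 0)`: number of replenishment trips of capacity `Q`
needed to fulfill a demand of `k` with remaining quantity `q`. -/
noncomputable def psi (Q k q : ℕ) : ℤ :=
  max ⌈((k : ℚ) - (q : ℚ)) / (Q : ℚ)⌉ 0

/-- The single-step optimal-restocking update operator `T_{i,m}`: extending a
label at current customer `m` backwardly to customer `i`.  The expected
remaining-cost function `ν : {0,…,Q} → ℝ` is modeled as `ν : ℕ → ℝ`; the
post-service remaining quantity `Q·Ψ(k,q)+q−k` (an integer in `{0,…,Q}`) is
passed via `Int.toNat`. -/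
noncomputable def stepT (Q : ℕ) (d p : ℕ → ℕ → ℝ) (i m : ℕ)
    (ν : ℕ → ℝ) (q : ℕ) : ℝ :=
  min
    (d i m + ∑' k : ℕ,
      ((d m 0 + d 0 m) * (psi Q k q : ℝ)
        + ν ((Q : ℤ) * psi Q k q + (q : ℤ) - (k : ℤ)).toNat) * p m k)
    (d i 0 + d 0 m + ∑' k : ℕ,
      ((d m 0 + d 0 m) * (psi Q k Q : ℝ)
        + ν ((Q : ℤ) * psi Q k Q + (Q : ℤ) - (k : ℤ)).toNat) * p m k)

/-- Backward extension of a label `(current customer, ν, Γ)` along a finite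
sequence of customers: extending a label with current customer `m` to customer
`i` replaces `ν` by `T_{i,m} ν`, adds `γ(i,m)` to `Γ`, and sets the current
customer to `i`. -/
noncomputable def extendLabel (Q : ℕ) (d p γ : ℕ → ℕ → ℝ) :
    ℕ × (ℕ → ℝ) × ℝ → List ℕ → ℕ × (ℕ → ℝ) × ℝ
  | L, [] => L
  | (m, ν, Γ), i :: rest =>
      extendLabel Q d p γ (i, stepT Q d p i m ν, Γ + γ i m) rest

lemma psi_nonneg (Q k q : ℕ) : 0 ≤ psi Q k q := le_max_right _ _

lemma psi_le (Q k q : ℕ) (hQ : 1 ≤ Q) : psi Q k q ≤ k := by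
  have hQ' : (1 : ℚ) ≤ Q := by exact_mod_cast hQ
  refine max_le (Int.ceil_le.2 ?_) (by positivity)
  rw [div_le_iff₀ (by linarith)]
  push_cast
  nlinarith [Nat.cast_nonneg (α := ℚ) k, Nat.cast_nonneg (α := ℚ) q]

/-- The quantity remaining after service does not exceed the vehicle capacity. -/
lemma toNat_remaining_le (Q k q : ℕ) (hQ : 1 ≤ Q) (hq : q ≤ Q) :
    ((Q : ℤ) * psi Q k q + (q : ℤ) - (k : ℤ)).toNat ≤ Q := by
  have hQ' : (0 : ℚ) < Q := by exact_mod_cast hQ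
  rw [Int.toNat_le]
  unfold psi
  rcases le_total ⌈((k : ℚ) - (q : ℚ)) / (Q : ℚ)⌉ 0 with h | h
  · rw [max_eq_right h]
    omega
  · rw [max_eq_left h]
    have hc := Int.ceil_lt_add_one (((k : ℚ) - (q : ℚ)) / (Q : ℚ))
    rw [div_add_one hQ'.ne', lt_div_iff₀ hQ'] at hc
    have hc' : ⌈((k : ℚ) - (q : ℚ)) / (Q : ℚ)⌉ * (Q : ℤ) < (k : ℤ) - q + Q := by
      exact_mod_cast hc
    linarith

/-- The series defining the expected remaining cost converges when demand has finite mean. -/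
lemma summable_expected_cost (Q q : ℕ) (hQ : 1 ≤ Q) (hq : q ≤ Q) (c : ℝ) (ν w : ℕ → ℝ)
    (hw : ∀ k, 0 ≤ w k) (hs : Summable w) (hmean : Summable fun k : ℕ => (k : ℝ) * w k) :
    Summable fun k : ℕ =>
      (c * (psi Q k q : ℝ) + ν ((Q : ℤ) * psi Q k q + (q : ℤ) - (k : ℤ)).toNat) * w k := by
  refine Summable.of_norm_bounded
    ((hmean.mul_left |c|).add (hs.mul_left (∑ j ∈ Finset.range (Q + 1), |ν j|))) fun k => ?_
  have hν : |ν ((Q : ℤ) * psi Q k q + (q : ℤ) - (k : ℤ)).toNat|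
      ≤ ∑ j ∈ Finset.range (Q + 1), |ν j| :=
    Finset.single_le_sum (f := fun j => |ν j|) (fun _ _ => abs_nonneg _)
      (Finset.mem_range_succ_iff.2 (toNat_remaining_le Q k q hQ hq))
  have h0 : (0 : ℝ) ≤ psi Q k q := by exact_mod_cast psi_nonneg Q k q
  have h1 : (psi Q k q : ℝ) ≤ k := by exact_mod_cast psi_le Q k q hQ
  rw [Real.norm_eq_abs, abs_mul, abs_of_nonneg (hw k), ← mul_assoc, ← add_mul]
  refine mul_le_mul_of_nonneg_right ((abs_add_le _ _).trans (add_le_add ?_ hν)) (hw k)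
  rw [abs_mul, abs_of_nonneg h0]
  exact mul_le_mul_of_nonneg_left h1 (abs_nonneg c)

/-- The expected remaining cost is monotone in the cost function on `{0,…,Q}`. -/
lemma expected_cost_mono (Q q : ℕ) (hQ : 1 ≤ Q) (hq : q ≤ Q) (c : ℝ) (ν₁ ν₂ w : ℕ → ℝ)
    (hw : ∀ k, 0 ≤ w k) (hs : Summable w) (hmean : Summable fun k : ℕ => (k : ℝ) * w k)
    (hν : ∀ q : ℕ, q ≤ Q → ν₁ q ≤ ν₂ q) :
    ∑' k : ℕ, (c * (psi Q k q : ℝ)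
        + ν₁ ((Q : ℤ) * psi Q k q + (q : ℤ) - (k : ℤ)).toNat) * w k
      ≤ ∑' k : ℕ, (c * (psi Q k q : ℝ)
        + ν₂ ((Q : ℤ) * psi Q k q + (q : ℤ) - (k : ℤ)).toNat) * w k :=
  Summable.tsum_le_tsum
    (fun k => mul_le_mul_of_nonneg_right
      (add_le_add_right (hν _ (toNat_remaining_le Q k q hQ hq)) _) (hw k))
    (summable_expected_cost Q q hQ hq c ν₁ w hw hs hmean)
    (summable_expected_cost Q q hQ hq c ν₂ w hw hs hmean)

lemma stepT_mono (Q : ℕ) (hQ : 1 ≤ Q) (d p : ℕ → ℕ → ℝ) (i m : ℕ) (hw : ∀ k, 0 ≤ p m k)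
    (hs : Summable (p m)) (hmean : Summable fun k : ℕ => (k : ℝ) * p m k) (ν₁ ν₂ : ℕ → ℝ)
    (hν : ∀ q : ℕ, q ≤ Q → ν₁ q ≤ ν₂ q) (q : ℕ) (hq : q ≤ Q) :
    stepT Q d p i m ν₁ q ≤ stepT Q d p i m ν₂ q :=
  min_le_min
    (add_le_add_right (expected_cost_mono Q q hQ hq _ ν₁ ν₂ (p m) hw hs hmean hν) _)
    (add_le_add_right (expected_cost_mono Q Q hQ le_rfl _ ν₁ ν₂ (p m) hw hs hmean hν) _)

/-- Proposition 1 of the paper, ν- and Γ-components: dominance in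
the `ν`- and `Γ`-attributes of a label is preserved by common backward
extensions along any finite sequence of customers. -/
theorem stmt4 (Q N : ℕ) (hQ : 1 ≤ Q)
    (d : ℕ → ℕ → ℝ) (hd : ∀ i j, i ≤ N → j ≤ N → 0 ≤ d i j)
    (p : ℕ → ℕ → ℝ)
    (hp : ∀ m, 1 ≤ m → m ≤ N →
      (∀ k, 0 ≤ p m k) ∧ HasSum (p m) 1 ∧ Summable fun k : ℕ => (k : ℝ) * p m k)
    (γ : ℕ → ℕ → ℝ)
    (n₀ : ℕ) (hn₀ : 1 ≤ n₀ ∧ n₀ ≤ N)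
    (ν₁ ν₂ : ℕ → ℝ) (hν : ∀ q : ℕ, q ≤ Q → ν₁ q ≤ ν₂ q)
    (Γ₁ Γ₂ : ℝ) (hΓ : Γ₁ ≤ Γ₂)
    (e : List ℕ) (he : ∀ i ∈ e, 1 ≤ i ∧ i ≤ N) :
    (extendLabel Q d p γ (n₀, ν₁, Γ₁) e).1 = (extendLabel Q d p γ (n₀, ν₂, Γ₂) e).1 ∧
    (∀ q : ℕ, q ≤ Q →
      (extendLabel Q d p γ (n₀, ν₁, Γ₁) e).2.1 q ≤ (extendLabel Q d p γ (n₀, ν₂, Γ₂) e).2.1 q) ∧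
    (extendLabel Q d p γ (n₀, ν₁, Γ₁) e).2.2 ≤ (extendLabel Q d p γ (n₀, ν₂, Γ₂) e).2.2 := by
  induction e generalizing n₀ ν₁ ν₂ Γ₁ Γ₂ with
  | nil => exact ⟨rfl, hν, hΓ⟩
  | cons i rest ih =>
    obtain ⟨hw, hs, hmean⟩ := hp n₀ hn₀.1 hn₀.2
    exact ih i (he i List.mem_cons_self) _ _
      (stepT_mono Q hQ d p i n₀ hw hs.summable hmean ν₁ ν₂ hν)
      _ _ (add_le_add_left hΓ _) fun j hj => he j (List.mem_cons_of_mem i hj)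
end

section
/- (Proposition 2(i) of the paper: transfer of ng-feasible extensions.) Let C = {1,…,N} be the set of customers, let each customer i have a neighborhood η_i ⊆ C with i ∈ η_i, and let μ_i ≥ 0 be its expected demand. A backward ng-label state is a pair (M, rl) with M ⊆ C (forbidden set) and rl ∈ ℝ (remaining load); an extension to customer i is permitted from (M, rl) iff i ∉ M and μ_i ≤ rl, and produces the state ((M ∩ η_i) ∪ {i}, rl − μ_i). Suppose (M¹, rl¹) and (M², rl²) satisfy M¹ ⊆ M² and rl¹ ≥ rl². Then every finite sequence of customers (i_1,…,i_h) whose successive extensions are permitted from (M², rl²) also has all its successive extensions permitted from (M¹, rl¹), and the resulting final states (M¹', rl¹') and (M²', rl²') again satisfy M¹' ⊆ M²' and rl¹' ≥ rl²'. -/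
/-- One backward ng-label extension step: extending state `(M, rl)` to customer
`i` produces `((M ∩ η i) ∪ {i}, rl − μ i)`. -/
def ngStep (η : ℕ → Finset ℕ) (μ : ℕ → ℝ) (s : Finset ℕ × ℝ) (i : ℕ) :
    Finset ℕ × ℝ :=
  ((s.1 ∩ η i) ∪ {i}, s.2 - μ i)

/-- A finite sequence of customers has all its successive extensions permitted
from state `(M, rl)`: each extension to `i` requires `i ∉ M` and `μ i ≤ rl`. -/
def ngPermitted (η : ℕ → Finset ℕ) (μ : ℕ → ℝ) :
    Finset ℕ × ℝ → List ℕ → Prop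
  | _, [] => True
  | s, i :: rest => (i ∉ s.1 ∧ μ i ≤ s.2) ∧ ngPermitted η μ (ngStep η μ s i) rest

/-- An extension step is monotone in the forbidden set and in the remaining load. -/
theorem ngStep_mono (η : ℕ → Finset ℕ) (μ : ℕ → ℝ) {s t : Finset ℕ × ℝ}
    (hM : s.1 ⊆ t.1) (hrl : t.2 ≤ s.2) (i : ℕ) :
    (ngStep η μ s i).1 ⊆ (ngStep η μ t i).1 ∧ (ngStep η μ t i).2 ≤ (ngStep η μ s i).2 :=
  ⟨Finset.union_subset_union_left (Finset.inter_subset_inter_right hM),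
    sub_le_sub_right hrl (μ i)⟩

/-- Permitted sequences transfer to a dominating state, and domination is preserved. -/
theorem ngPermitted_transfer (η : ℕ → Finset ℕ) (μ : ℕ → ℝ) (L : List ℕ)
    {s t : Finset ℕ × ℝ} (hM : s.1 ⊆ t.1) (hrl : t.2 ≤ s.2) (hperm : ngPermitted η μ t L) :
    ngPermitted η μ s L ∧
    (List.foldl (ngStep η μ) s L).1 ⊆ (List.foldl (ngStep η μ) t L).1 ∧
    (List.foldl (ngStep η μ) t L).2 ≤ (List.foldl (ngStep η μ) s L).2 := by
  induction L generalizing s t with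
  | nil => exact ⟨trivial, hM, hrl⟩
  | cons i rest ih =>
    obtain ⟨⟨hi, hload⟩, hrest⟩ := hperm
    obtain ⟨hM', hrl'⟩ := ngStep_mono η μ hM hrl i
    obtain ⟨hp, hfinal⟩ := ih hM' hrl' hrest
    exact ⟨⟨⟨fun h => hi (hM h), hload.trans hrl⟩, hp⟩, hfinal⟩

/-- Proposition 2(i) of the paper: transfer of ng-feasible
extensions: if `M¹ ⊆ M²` and `rl¹ ≥ rl²`, then every finite sequence of
customers whose successive extensions are permitted from `(M², rl²)` also has
all its successive extensions permitted from `(M¹, rl¹)`, and the resulting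
final states again satisfy `M¹' ⊆ M²'` and `rl¹' ≥ rl²'`. -/
theorem stmt7 (N : ℕ) (η : ℕ → Finset ℕ)
    (hη : ∀ i ∈ Finset.Icc 1 N, i ∈ η i)
    (hηC : ∀ i ∈ Finset.Icc 1 N, η i ⊆ Finset.Icc 1 N)
    (μ : ℕ → ℝ) (hμ : ∀ i ∈ Finset.Icc 1 N, 0 ≤ μ i)
    (M₁ M₂ : Finset ℕ) (hM₁C : M₁ ⊆ Finset.Icc 1 N) (hM₂C : M₂ ⊆ Finset.Icc 1 N)
    (rl₁ rl₂ : ℝ) (hM : M₁ ⊆ M₂) (hrl : rl₂ ≤ rl₁)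
    (L : List ℕ) (hL : ∀ i ∈ L, i ∈ Finset.Icc 1 N)
    (hperm : ngPermitted η μ (M₂, rl₂) L) :
    ngPermitted η μ (M₁, rl₁) L ∧
    (List.foldl (ngStep η μ) (M₁, rl₁) L).1 ⊆ (List.foldl (ngStep η μ) (M₂, rl₂) L).1 ∧
    (List.foldl (ngStep η μ) (M₂, rl₂) L).2 ≤ (List.foldl (ngStep η μ) (M₁, rl₁) L).2 := by
  exact ngPermitted_transfer η μ L hM hrl hperm
end
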